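/- Let Φ : M_n(ℂ) → M_n(ℂ) be a positive, unital, trace-preserving linear map, let σ ∈ M_n(ℂ) be positive semidefinite with Φ(σ) = σ, and let ρ ∈ M_n(ℂ) be positive semidefinite with supp ρ ⊆ supp σ. Let α, z ∈ ℝ with 0 < α < 1 and α ≤ z ≤ 1. Then Tr( ( σ^{(1−α)/(2z)} Φ(ρ)^{α/z} σ^{(1−α)/(2z)} )^z ) = Tr( ( σ^{(1−α)/(2z)} ρ^{α/z} σ^{(1−α)/(2z)} )^z ) holds if and only if Φ*(Φ(ρ)) = ρ and Φ*(Φ(σ)) = σ; that is, the α-z-Rényi divergence D_{α,z}(ρ‖σ) is preserved by Φ if and only if Φ*∘Φ fixes both ρ and σ. -/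

import Mathlib

open Matrix
open scoped ComplexOrder

/-- Moore–Penrose power of a matrix: apply `x ↦ x ^ t` to the nonzero eigenvalues
(with `0 ^ t := 0`) via the continuous functional calculus. -/
noncomputable def mpow {n : ℕ} (A : Matrix (Fin n) (Fin n) ℂ) (t : ℝ) :
    Matrix (Fin n) (Fin n) ℂ :=
  cfc (fun x : ℝ => if x = 0 then 0 else x ^ t) A

/-- The adjoint of a linear map between matrix spaces with respect to the
Hilbert–Schmidt inner product `⟨A, B⟩ = Tr(Aᴴ B)`. -/
noncomputable def adjointMap {n m : ℕ}
    (Φ : Matrix (Fin n) (Fin n) ℂ →ₗ[ℂ] Matrix (Fin m) (Fin m) ℂ) :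
    Matrix (Fin m) (Fin m) ℂ → Matrix (Fin n) (Fin n) ℂ :=
  fun Y => Matrix.of fun i j => Matrix.trace ((Φ (Matrix.single i j 1))ᴴ * Y)

open scoped MatrixOrder

section Spectral

variable {n : ℕ} {A B : Matrix (Fin n) (Fin n) ℂ}

/-- The rank-one spectral projection of a Hermitian matrix onto its `i`-th eigenvector. -/
noncomputable def eigenproj (hA : A.IsHermitian) (i : Fin n) : Matrix (Fin n) (Fin n) ℂ :=
  Unitary.conjStarAlgAut ℂ _ hA.eigenvectorUnitary (Matrix.single i i 1)

lemma eigenproj_posSemidef (hA : A.IsHermitian) (i : Fin n) : (eigenproj hA i).PosSemidef := by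
  have h : (Matrix.single i i (1 : ℂ)).PosSemidef := by
    rw [← Matrix.diagonal_single]
    refine Matrix.PosSemidef.diagonal fun j => ?_
    by_cases hj : j = i <;> simp [hj]
  rw [eigenproj, Unitary.conjStarAlgAut_apply]
  exact h.mul_mul_conjTranspose_same _

lemma trace_eigenproj (hA : A.IsHermitian) (i : Fin n) : (eigenproj hA i).trace = 1 := by
  rw [eigenproj, Unitary.conjStarAlgAut_apply, Matrix.trace_mul_cycle]
  simp

lemma sum_eigenproj (hA : A.IsHermitian) : ∑ i, eigenproj hA i = 1 := by
  simp_rw [eigenproj, ← map_sum]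
  rw [Matrix.sum_single_one, map_one]

lemma eigenproj_mul (hA : A.IsHermitian) (i j : Fin n) :
    eigenproj hA i * eigenproj hA j = if i = j then eigenproj hA i else 0 := by
  rw [eigenproj, eigenproj, ← map_mul]
  split_ifs with h
  · subst h; simp
  · simp [Matrix.single_mul_single_of_ne, h]

lemma cfc_eq_sum_eigenproj (hA : A.IsHermitian) (f : ℝ → ℝ) :
    cfc f A = ∑ i, (f (hA.eigenvalues i) : ℂ) • eigenproj hA i := by
  rw [hA.cfc_eq, Matrix.IsHermitian.cfc]
  simp_rw [eigenproj, ← map_smul, ← map_sum]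
  congr 1
  ext a b
  simp [Matrix.diagonal_apply, Matrix.sum_apply, Matrix.single_apply, ite_and]

lemma eq_sum_eigenproj (hA : A.IsHermitian) :
    A = ∑ i, (hA.eigenvalues i : ℂ) • eigenproj hA i := by
  have h : cfc (id : ℝ → ℝ) A = A := cfc_id ℝ A (ha := hA)
  simpa [h] using cfc_eq_sum_eigenproj hA id

lemma trace_cfc (hA : A.IsHermitian) (f : ℝ → ℝ) :
    (cfc f A).trace = ∑ i, (f (hA.eigenvalues i) : ℂ) := by
  simp [cfc_eq_sum_eigenproj hA, Matrix.trace_sum, trace_eigenproj]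

lemma continuousOn_spectrum (A : Matrix (Fin n) (Fin n) ℂ) (f : ℝ → ℝ) :
    ContinuousOn f (spectrum ℝ A) :=
  (Matrix.finite_real_spectrum (A := A)).continuousOn f

lemma cfc_mul_cfc (A : Matrix (Fin n) (Fin n) ℂ) (f g : ℝ → ℝ) :
    cfc f A * cfc g A = cfc (fun x => f x * g x) A :=
  (cfc_mul f g A (continuousOn_spectrum A f) (continuousOn_spectrum A g)).symm

lemma isHermitian_cfc (A : Matrix (Fin n) (Fin n) ℂ) (f : ℝ → ℝ) : (cfc f A).IsHermitian :=
  cfc_predicate f A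

lemma mul_cfc (hA : A.IsHermitian) (f : ℝ → ℝ) : A * cfc f A = cfc (fun x => x * f x) A :=
  (congrArg (· * cfc f A) (cfc_id' ℝ A (ha := hA)).symm).trans (cfc_mul_cfc A (fun x => x) f)

lemma cfc_mul_right (hA : A.IsHermitian) (f : ℝ → ℝ) : cfc f A * A = cfc (fun x => f x * x) A :=
  (congrArg (cfc f A * ·) (cfc_id' ℝ A (ha := hA)).symm).trans (cfc_mul_cfc A f fun x => x)

lemma trace_mul_self (hA : A.IsHermitian) :
    (A * A).trace = ∑ i, ((hA.eigenvalues i * hA.eigenvalues i : ℝ) : ℂ) := by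
  have h : A * A = cfc (fun x : ℝ => x * x) A :=
    (congrArg (A * ·) (cfc_id' ℝ A (ha := hA)).symm).trans (mul_cfc hA fun x => x)
  rw [h, trace_cfc hA]

lemma cfc_congr_eigenvalues (hA : A.IsHermitian) {f g : ℝ → ℝ}
    (h : ∀ i, f (hA.eigenvalues i) = g (hA.eigenvalues i)) : cfc f A = cfc g A := by
  simp [cfc_eq_sum_eigenproj hA, h]

lemma cfc_posSemidef (hA : A.IsHermitian) {f : ℝ → ℝ} (h : ∀ i, 0 ≤ f (hA.eigenvalues i)) :
    (cfc f A).PosSemidef := by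
  rw [cfc_eq_sum_eigenproj hA]
  exact Matrix.posSemidef_sum _ fun i _ =>
    (eigenproj_posSemidef hA i).smul (by exact_mod_cast h i)

lemma eq_of_posSemidef_sub_of_trace_eq (h : (A - B).PosSemidef) (ht : A.trace = B.trace) :
    A = B :=
  sub_eq_zero.1 (h.trace_eq_zero_iff.1 (by rw [Matrix.trace_sub, ht, sub_self]))

lemma eq_of_posSemidef_sub_of_re_trace_eq (h : (A - B).PosSemidef)
    (ht : A.trace.re = B.trace.re) : A = B := by
  refine eq_of_posSemidef_sub_of_trace_eq h (Complex.ext ht ?_)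
  have := (Complex.nonneg_iff.1 h.trace_nonneg).2
  rw [Matrix.trace_sub, Complex.sub_im] at this
  linarith

lemma trace_mul_nonneg (hA : A.PosSemidef) (hB : B.PosSemidef) : 0 ≤ (A * B).trace := by
  obtain ⟨C, rfl⟩ := CStarAlgebra.nonneg_iff_eq_star_mul_self.1 hA.nonneg
  rw [Matrix.star_eq_conjTranspose, Matrix.mul_assoc, Matrix.trace_mul_comm]
  exact (hB.mul_mul_conjTranspose_same C).trace_nonneg

end Spectral

section MPow

variable {n : ℕ} {A B : Matrix (Fin n) (Fin n) ℂ}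

lemma mpow_eq_cfc_rpow (A : Matrix (Fin n) (Fin n) ℂ) {t : ℝ} (ht : 0 < t) :
    mpow A t = cfc (fun x : ℝ => x ^ t) A := by
  unfold mpow
  congr 1
  ext x
  split_ifs with h
  · rw [h, Real.zero_rpow ht.ne']
  · rfl

lemma isHermitian_mpow (A : Matrix (Fin n) (Fin n) ℂ) (t : ℝ) : (mpow A t).IsHermitian :=
  isHermitian_cfc _ _

lemma mpow_one (hA : A.IsHermitian) : mpow A 1 = A := by
  simp_rw [mpow_eq_cfc_rpow A one_pos, Real.rpow_one]
  exact cfc_id' ℝ A (ha := hA)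

lemma mpow_posSemidef (hA : A.PosSemidef) (t : ℝ) : (mpow A t).PosSemidef := by
  refine cfc_posSemidef hA.isHermitian fun i => ?_
  split_ifs
  · exact le_rfl
  · exact Real.rpow_nonneg (hA.eigenvalues_nonneg i) t

lemma mpow_mpow (hA : A.PosSemidef) {s t : ℝ} (hs : 0 < s) (ht : 0 < t) :
    mpow (mpow A s) t = mpow A (s * t) := by
  rw [mpow_eq_cfc_rpow _ hs, mpow_eq_cfc_rpow _ ht, mpow_eq_cfc_rpow _ (mul_pos hs ht)]
  have h := cfc_comp' (ha := hA.isHermitian) (fun x : ℝ => x ^ t) (fun x : ℝ => x ^ s) A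
    (((Matrix.finite_real_spectrum (A := A)).image _).continuousOn _) (continuousOn_spectrum _ _)
  refine Eq.trans h.symm ?_
  exact cfc_congr_eigenvalues hA.isHermitian fun i =>
    (Real.rpow_mul (hA.eigenvalues_nonneg i) s t).symm

open scoped Matrix.Norms.L2Operator in
lemma mpow_eq_rpow (hA : A.PosSemidef) {t : ℝ} (ht : 0 < t) : mpow A t = A ^ t := by
  rw [mpow_eq_cfc_rpow _ ht, CFC.rpow_eq_cfc_real (Matrix.nonneg_iff_posSemidef.2 hA)]

open scoped Matrix.Norms.L2Operator in
lemma mpow_sub_mpow_posSemidef (hB : B.PosSemidef) (h : (A - B).PosSemidef) {t : ℝ}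
    (ht0 : 0 < t) (ht1 : t ≤ 1) : (mpow A t - mpow B t).PosSemidef := by
  have hA : A.PosSemidef := by simpa using h.add hB
  rw [mpow_eq_rpow hA ht0, mpow_eq_rpow hB ht0]
  exact CFC.rpow_le_rpow ⟨ht0.le, ht1⟩ (Matrix.le_iff.2 h)

lemma eq_of_trace_mpow_eq (hB : B.PosSemidef) (h : (A - B).PosSemidef) {t : ℝ}
    (ht0 : 0 < t) (ht1 : t ≤ 1) (htr : (mpow A t).trace.re = (mpow B t).trace.re) : A = B := by
  have hA : A.PosSemidef := by simpa using h.add hB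
  have := eq_of_posSemidef_sub_of_re_trace_eq (mpow_sub_mpow_posSemidef hB h ht0 ht1) htr
  have h2 := congrArg (fun X => mpow X t⁻¹) this
  simpa [mpow_mpow hA ht0 (inv_pos.2 ht0), mpow_mpow hB ht0 (inv_pos.2 ht0), ht0.ne',
    mpow_one hA.isHermitian, mpow_one hB.isHermitian] using h2

end MPow

/-- A positive, unital and trace-preserving linear map on square matrices. -/
structure IsPosUnitalTP {n : ℕ}
    (Φ : Matrix (Fin n) (Fin n) ℂ →ₗ[ℂ] Matrix (Fin n) (Fin n) ℂ) : Prop where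
  pos : ∀ X, X.PosSemidef → (Φ X).PosSemidef
  unital : Φ 1 = 1
  trace_map : ∀ X, (Φ X).trace = X.trace

namespace IsPosUnitalTP

variable {n : ℕ} {Φ : Matrix (Fin n) (Fin n) ℂ →ₗ[ℂ] Matrix (Fin n) (Fin n) ℂ}
  {A M X Y : Matrix (Fin n) (Fin n) ℂ}

lemma map_cfc (Φ : Matrix (Fin n) (Fin n) ℂ →ₗ[ℂ] Matrix (Fin n) (Fin n) ℂ)
    (hA : A.IsHermitian) (f : ℝ → ℝ) :
    Φ (cfc f A) = ∑ i, (f (hA.eigenvalues i) : ℂ) • Φ (eigenproj hA i) := by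
  rw [cfc_eq_sum_eigenproj hA, map_sum]
  simp_rw [map_smul]

lemma isHermitian_map (hΦ : IsPosUnitalTP Φ) (hA : A.IsHermitian) : (Φ A).IsHermitian := by
  rw [eq_sum_eigenproj hA, map_sum]
  simp_rw [map_smul]
  rw [Matrix.IsHermitian, Matrix.conjTranspose_sum]
  refine Finset.sum_congr rfl fun i _ => ?_
  rw [Matrix.conjTranspose_smul, (hΦ.pos _ (eigenproj_posSemidef hA i)).isHermitian.eq]
  simp

lemma map_conjTranspose (hΦ : IsPosUnitalTP Φ) (X : Matrix (Fin n) (Fin n) ℂ) :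
    Φ Xᴴ = (Φ X)ᴴ := by
  obtain ⟨H, K, hH, hK, rfl⟩ : ∃ H K : Matrix (Fin n) (Fin n) ℂ, H.IsHermitian ∧ K.IsHermitian ∧
      X = H + Complex.I • K :=
    ⟨realPart X, imaginaryPart X, (realPart X).2, (imaginaryPart X).2,
      (realPart_add_I_smul_imaginaryPart X).symm⟩
  simp [hH.eq, hK.eq, (hΦ.isHermitian_map hH).eq, (hΦ.isHermitian_map hK).eq]

/-- Positivity of `Φ` applied to the quadratic form `(f - g M)ᴴ (f - g M)`, where `f` and `g` are
functions of the Hermitian matrix `A`. -/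
lemma quadratic_posSemidef (hΦ : IsPosUnitalTP Φ) (hA : A.IsHermitian) (hM : M.IsHermitian)
    (f g : ℝ → ℝ) :
    (Φ (cfc (fun x => f x * f x) A) - Φ (cfc (fun x => f x * g x) A) * M
      - M * Φ (cfc (fun x => f x * g x) A)
      + M * Φ (cfc (fun x => g x * g x) A) * M).PosSemidef := by
  have h : ∀ i, (((f (hA.eigenvalues i) : ℂ) • 1 - (g (hA.eigenvalues i) : ℂ) • M)
      * Φ (eigenproj hA i)
      * ((f (hA.eigenvalues i) : ℂ) • 1 - (g (hA.eigenvalues i) : ℂ) • M)ᴴ).PosSemidef :=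
    fun i => (hΦ.pos _ (eigenproj_posSemidef hA i)).mul_mul_conjTranspose_same _
  convert Matrix.posSemidef_sum Finset.univ fun i _ => h i using 1
  simp_rw [map_cfc Φ hA, Finset.mul_sum, Finset.sum_mul, ← Finset.sum_sub_distrib,
    ← Finset.sum_add_distrib]
  refine Finset.sum_congr rfl fun i _ => ?_
  rw [Matrix.conjTranspose_sub, Matrix.conjTranspose_smul, Matrix.conjTranspose_smul, hM.eq]
  simp only [Matrix.conjTranspose_one, RCLike.star_def, Complex.conj_ofReal, sub_mul, mul_sub,
    smul_mul_assoc, mul_smul_comm, one_mul, mul_one, smul_smul, Complex.ofReal_mul, smul_sub]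
  rw [mul_comm (g _ : ℂ) (f _ : ℂ)]
  abel

/-- Kadison's inequality. -/
lemma kadison (hΦ : IsPosUnitalTP Φ) (hA : A.IsHermitian) :
    (Φ (A * A) - Φ A * Φ A).PosSemidef := by
  have h := hΦ.quadratic_posSemidef hA (hΦ.isHermitian_map hA) (fun x => x) (fun _ => 1)
  have h1 : cfc (fun x : ℝ => x) A = A := cfc_id' ℝ A (ha := hA)
  have h2 : cfc (fun _ : ℝ => (1 : ℝ)) A = 1 := cfc_const_one ℝ A (ha := hA)
  simp only [← cfc_mul_cfc A (fun x => x), mul_one, h1, h2, hΦ.unital] at h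
  simpa using h

lemma resolvent_posSemidef (hΦ : IsPosUnitalTP Φ) (hA : A.PosSemidef) {t : ℝ} (ht : 0 < t) :
    (Φ (cfc (fun x : ℝ => (t + x)⁻¹) A) - cfc (fun x : ℝ => (t + x)⁻¹) (Φ A)).PosSemidef := by
  have hB := hΦ.pos A hA
  set R := cfc (fun x : ℝ => (t + x)⁻¹) (Φ A) with hR
  have h := hΦ.quadratic_posSemidef hA.isHermitian (isHermitian_cfc (Φ A) (fun x : ℝ => (t + x)⁻¹))
    (fun x => √(t + x)⁻¹) (fun x => √(t + x))
  have hpos : ∀ i, 0 < t + hA.isHermitian.eigenvalues i := fun i => by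
    linarith [hA.eigenvalues_nonneg i]
  have hff : cfc (fun x => √(t + x)⁻¹ * √(t + x)⁻¹) A = cfc (fun x : ℝ => (t + x)⁻¹) A :=
    cfc_congr_eigenvalues hA.isHermitian fun i =>
      Real.mul_self_sqrt (inv_nonneg.2 (hpos i).le)
  have hgg : cfc (fun x => √(t + x) * √(t + x)) A = cfc (fun x : ℝ => t + x) A :=
    cfc_congr_eigenvalues hA.isHermitian fun i => Real.mul_self_sqrt (hpos i).le
  have hfg : cfc (fun x => √(t + x)⁻¹ * √(t + x)) A = 1 := by
    rw [← cfc_const_one ℝ A (ha := hA.isHermitian)]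
    refine cfc_congr_eigenvalues hA.isHermitian fun i => ?_
    rw [Real.sqrt_inv, inv_mul_cancel₀ (Real.sqrt_pos.2 (hpos i)).ne']
  have hlin : ∀ {Z : Matrix (Fin n) (Fin n) ℂ}, Z.IsHermitian →
      cfc (fun x : ℝ => t + x) Z = (t : ℂ) • 1 + Z := fun {Z} hZ => by
    rw [cfc_eq_sum_eigenproj hZ]
    simp_rw [Complex.ofReal_add, add_smul, Finset.sum_add_distrib, ← eq_sum_eigenproj hZ,
      ← Finset.smul_sum, sum_eigenproj]
  have hΦlin : Φ (cfc (fun x : ℝ => t + x) A) = cfc (fun x : ℝ => t + x) (Φ A) := by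
    rw [hlin hA.isHermitian, hlin hB.isHermitian, map_add, map_smul, hΦ.unital]
  have hinv : R * cfc (fun x : ℝ => t + x) (Φ A) = 1 := by
    rw [hR, cfc_mul_cfc, ← cfc_const_one ℝ (Φ A) (ha := hB.isHermitian)]
    refine cfc_congr_eigenvalues hB.isHermitian fun i => inv_mul_cancel₀ ?_
    linarith [hB.eigenvalues_nonneg i]
  rw [hff, hgg, hfg, hΦlin, hΦ.unital, ← hR, hinv] at h
  simpa using h

/-- The operator Jensen inequality for the power functions with exponent in `(0, 1]`. -/
lemma mpow_map_sub_posSemidef (hΦ : IsPosUnitalTP Φ) (hA : A.PosSemidef) {p : ℝ} (hp0 : 0 < p)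
    (hp1 : p ≤ 1) : (mpow (Φ A) p - Φ (mpow A p)).PosSemidef := by
  have hB := hΦ.pos A hA
  rcases hp1.eq_or_lt with rfl | hp1
  · rw [mpow_one hB.isHermitian, mpow_one hA.isHermitian, sub_self]
    exact Matrix.PosSemidef.zero
  refine .of_dotProduct_mulVec_nonneg
    ((isHermitian_mpow _ _).sub (hΦ.isHermitian_map (isHermitian_mpow _ _))) fun v => ?_
  set F : (ℝ → ℝ) → ℝ := fun f => (star v ⬝ᵥ ((cfc f (Φ A) - Φ (cfc f A)) *ᵥ v)).re with hF
  set a := hA.isHermitian.eigenvalues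
  set b := hB.isHermitian.eigenvalues
  set c : Fin n → ℝ := fun j => (star v ⬝ᵥ (eigenproj hB.isHermitian j *ᵥ v)).re
  set d : Fin n → ℝ := fun i => (star v ⬝ᵥ (Φ (eigenproj hA.isHermitian i) *ᵥ v)).re
  have hFsum : ∀ f, F f = ∑ j, f (b j) * c j - ∑ i, f (a i) * d i := fun f => by
    simp only [hF, map_cfc Φ hA.isHermitian, cfc_eq_sum_eigenproj hB.isHermitian,
      Matrix.sub_mulVec, Matrix.sum_mulVec, Matrix.smul_mulVec, dotProduct_sub, dotProduct_sum,
      dotProduct_smul, smul_eq_mul, Complex.sub_re, Complex.re_sum, Complex.re_ofReal_mul]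
    rfl
  have hb : ∀ j, 0 ≤ b j := hB.eigenvalues_nonneg
  have ha : ∀ i, 0 ≤ a i := hA.eigenvalues_nonneg
  have hcd : ∑ j, c j = ∑ i, d i := by
    have h := hFsum fun _ => 1
    have h0 : F (fun _ => 1) = 0 := by
      have h1 : cfc (fun _ : ℝ => (1 : ℝ)) A = 1 := cfc_const_one ℝ A (ha := hA.isHermitian)
      have h2 : cfc (fun _ : ℝ => (1 : ℝ)) (Φ A) = 1 :=
        cfc_const_one ℝ (Φ A) (ha := hB.isHermitian)
      simp [hF, h1, h2, hΦ.unital]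
    simp only [h0, one_mul] at h
    linarith
  have hFt : ∀ t ∈ Set.Ioi (0 : ℝ), 0 ≤ F (Real.rpowIntegrand₀₁ p t) := fun t ht => by
    have h := (Complex.nonneg_iff.1
      ((hΦ.resolvent_posSemidef hA (Set.mem_Ioi.1 ht)).dotProduct_mulVec_nonneg v)).1
    have h' : F (fun x => (t + x)⁻¹) ≤ 0 := by
      rw [← neg_sub, Matrix.neg_mulVec, dotProduct_neg, Complex.neg_re] at h
      simpa [hF] using h
    have : F (Real.rpowIntegrand₀₁ p t) = - (t ^ p * F (fun x => (t + x)⁻¹)) := by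
      simp only [hFsum, Real.rpowIntegrand₀₁, mul_sub, sub_mul, Finset.sum_sub_distrib,
        ← Finset.mul_sum, hcd, mul_assoc]
      ring
    rw [this]
    have := Real.rpow_nonneg (Set.mem_Ioi.1 ht).le p
    nlinarith
  obtain ⟨μ, hμ⟩ := Real.exists_measure_rpow_eq_integral_rpowIntegrand₀₁ (p := p) ⟨hp0, hp1⟩
  have hint : F (fun x => x ^ p) = ∫ t in Set.Ioi 0, F (Real.rpowIntegrand₀₁ p t) ∂μ := by
    simp only [hFsum]
    rw [MeasureTheory.integral_sub
        (MeasureTheory.integrable_finsetSum _ fun j _ => (hμ (b j) (hb j)).1.mul_const _)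
        (MeasureTheory.integrable_finsetSum _ fun i _ => (hμ (a i) (ha i)).1.mul_const _),
      MeasureTheory.integral_finsetSum _ fun j _ => (hμ (b j) (hb j)).1.mul_const _,
      MeasureTheory.integral_finsetSum _ fun i _ => (hμ (a i) (ha i)).1.mul_const _]
    simp_rw [MeasureTheory.integral_mul_const]
    congr 1
    · exact Finset.sum_congr rfl fun j _ => by rw [(hμ (b j) (hb j)).2]
    · exact Finset.sum_congr rfl fun i _ => by rw [(hμ (a i) (ha i)).2]
  rw [mpow_eq_cfc_rpow _ hp0, mpow_eq_cfc_rpow _ hp0]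
  refine Complex.nonneg_iff.2 ⟨?_, ?_⟩
  · change 0 ≤ F (fun x => x ^ p)
    rw [hint]
    exact MeasureTheory.setIntegral_nonneg measurableSet_Ioi hFt
  · exact (((isHermitian_cfc _ _).sub
      (hΦ.isHermitian_map (isHermitian_cfc _ _))).im_star_dotProduct_mulVec_self v).symm

/-- Equality in Kadison's inequality puts `A` into the Jordan multiplicative domain. -/
lemma map_jordan (hΦ : IsPosUnitalTP Φ) (hA : A.IsHermitian) (hX : X.IsHermitian)
    (h : Φ (A * A) = Φ A * Φ A) : Φ (A * X + X * A) = Φ A * Φ X + Φ X * Φ A := by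
  set D := Φ (A * X + X * A) - (Φ A * Φ X + Φ X * Φ A) with hD
  set E := Φ (X * X) - Φ X * Φ X
  have hΦA := hΦ.isHermitian_map hA
  have hΦX := hΦ.isHermitian_map hX
  have hDherm : D.IsHermitian := by
    refine .sub (hΦ.isHermitian_map ?_) ?_
    · simp [Matrix.IsHermitian, hA.eq, hX.eq, add_comm]
    · simp [Matrix.IsHermitian, hΦA.eq, hΦX.eq, add_comm]
  have hpos : ∀ t : ℝ, ((t : ℂ) • D + E).PosSemidef := fun t => by
    have h1 : ((t : ℂ) • A + X).IsHermitian := by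
      simp [Matrix.IsHermitian, hA.eq, hX.eq]
    convert hΦ.kadison h1 using 1
    simp only [mul_add, add_mul, map_add, map_smul, smul_mul_assoc, mul_smul_comm, h, hD, E,
      smul_sub, smul_add]
    abel
  have hzero : ∀ v, star v ⬝ᵥ (D *ᵥ v) = 0 := fun v => by
    have hq : ∀ t : ℝ, 0 ≤ t * (star v ⬝ᵥ (D *ᵥ v)).re + (star v ⬝ᵥ (E *ᵥ v)).re := fun t => by
      have := (Complex.nonneg_iff.1 ((hpos t).dotProduct_mulVec_nonneg v)).1
      simpa [Matrix.add_mulVec, Matrix.smul_mulVec, dotProduct_add, dotProduct_smul] using this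
    refine Complex.ext ?_ (hDherm.im_star_dotProduct_mulVec_self v)
    by_contra hne
    change (star v ⬝ᵥ (D *ᵥ v)).re ≠ 0 at hne
    have := hq (-((star v ⬝ᵥ (E *ᵥ v)).re + 1) / (star v ⬝ᵥ (D *ᵥ v)).re)
    rw [div_mul_cancel₀ _ hne] at this
    linarith
  have h1 : (0 : Matrix (Fin n) (Fin n) ℂ) ≤ D := Matrix.nonneg_iff_posSemidef.2 <|
    .of_dotProduct_mulVec_nonneg hDherm fun v => (hzero v).ge
  have h2 : (0 : Matrix (Fin n) (Fin n) ℂ) ≤ -D := Matrix.nonneg_iff_posSemidef.2 <|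
    .of_dotProduct_mulVec_nonneg hDherm.neg fun v => by
      rw [Matrix.neg_mulVec, dotProduct_neg, hzero v, neg_zero]
  exact sub_eq_zero.1 (le_antisymm (neg_nonneg.1 h2) h1)

lemma map_mul_self_of_fixed (hΦ : IsPosUnitalTP Φ) (hA : A.IsHermitian) (h : Φ A = A) :
    Φ (A * A) = A * A := by
  have hk := hΦ.kadison hA
  rw [h] at hk
  exact eq_of_posSemidef_sub_of_trace_eq hk (hΦ.trace_map _)

lemma map_jordan_of_fixed (hΦ : IsPosUnitalTP Φ) (hA : A.IsHermitian) (hX : X.IsHermitian)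
    (h : Φ A = A) : Φ (A * X + X * A) = A * Φ X + Φ X * A := by
  have := hΦ.map_jordan hA hX (by rw [hΦ.map_mul_self_of_fixed hA h, h])
  rwa [h] at this

/-- Fixed points of `Φ` can be pulled out of two-sided products. -/
lemma map_sandwich_of_fixed (hΦ : IsPosUnitalTP Φ) (hA : A.IsHermitian) (hX : X.IsHermitian)
    (h : Φ A = A) : Φ (A * X * A) = A * Φ X * A := by
  have hAA : (A * A).IsHermitian := by simp [Matrix.IsHermitian, hA.eq]
  have hAX : (A * X + X * A).IsHermitian := by
    simp [Matrix.IsHermitian, hA.eq, hX.eq, add_comm]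
  have h1 := hΦ.map_jordan_of_fixed hA hX h
  have h2 := hΦ.map_jordan_of_fixed hA hAX h
  have h3 := hΦ.map_jordan_of_fixed hAA hX (hΦ.map_mul_self_of_fixed hA h)
  have e : A * (A * X + X * A) + (A * X + X * A) * A - (A * A * X + X * (A * A))
      = (2 : ℂ) • (A * X * A) := by rw [two_smul]; noncomm_ring
  have h4 : (2 : ℂ) • Φ (A * X * A) = (2 : ℂ) • (A * Φ X * A) := by
    rw [← map_smul, ← e, map_sub, h2, h3, h1, two_smul]
    noncomm_ring
  exact smul_right_injective _ two_ne_zero h4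

/-- Functions of a Hermitian fixed point are fixed points. -/
lemma map_cfc_of_fixed (hΦ : IsPosUnitalTP Φ) (hA : A.IsHermitian) (h : Φ A = A) (f : ℝ → ℝ) :
    Φ (cfc f A) = cfc f A := by
  have hpow : ∀ k : ℕ, Φ (cfc (fun x : ℝ => x ^ k) A) = cfc (fun x : ℝ => x ^ k) A := by
    intro k
    induction k with
    | zero =>
      have h1 : cfc (fun _ : ℝ => (1 : ℝ)) A = 1 := cfc_const_one ℝ A (ha := hA)
      simp [h1, hΦ.unital]
    | succ k ih =>
      have e1 : A * cfc (fun x : ℝ => x ^ k) A = cfc (fun x : ℝ => x ^ (k + 1)) A := by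
        simp_rw [mul_cfc hA, pow_succ']
      have e2 : cfc (fun x : ℝ => x ^ k) A * A = cfc (fun x : ℝ => x ^ (k + 1)) A := by
        simp_rw [cfc_mul_right hA, pow_succ]
      have := hΦ.map_jordan_of_fixed hA (isHermitian_cfc A fun x => x ^ k) h
      rw [ih, e1, e2, ← two_smul ℂ, map_smul] at this
      exact smul_right_injective _ two_ne_zero this
  have hpoly : ∀ q : Polynomial ℝ, Φ (cfc (fun x => q.eval x) A) = cfc (fun x => q.eval x) A := by
    intro q
    induction q using Polynomial.induction_on' with
    | add p q hp hq =>
      have : cfc (fun x => (p + q).eval x) A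
          = cfc (fun x => p.eval x) A + cfc (fun x => q.eval x) A := by
        simp [cfc_eq_sum_eigenproj hA, add_smul, Finset.sum_add_distrib]
      rw [this, map_add, hp, hq]
    | monomial k c =>
      have : cfc (fun x => (Polynomial.monomial k c).eval x) A
          = (c : ℂ) • cfc (fun x : ℝ => x ^ k) A := by
        simp [cfc_eq_sum_eigenproj hA, Finset.smul_sum, smul_smul]
      rw [this, map_smul, hpow]
  have hint : cfc f A = cfc (fun x =>
      (Lagrange.interpolate (Finset.univ.image hA.eigenvalues) id f).eval x) A := by
    refine cfc_congr_eigenvalues hA fun i => ?_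
    exact (Lagrange.eval_interpolate_at_node (v := id) f Function.injective_id.injOn
      (Finset.mem_image_of_mem _ (Finset.mem_univ i))).symm
  rw [hint, hpoly]

lemma re_trace_mpow_le (hΦ : IsPosUnitalTP Φ) (hA : A.PosSemidef) {q : ℝ} (hq0 : 0 < q)
    (hq1 : q ≤ 1) : (mpow A q).trace.re ≤ (mpow (Φ A) q).trace.re := by
  have h := (Complex.nonneg_iff.1 (hΦ.mpow_map_sub_posSemidef hA hq0 hq1).trace_nonneg).1
  rw [Matrix.trace_sub, hΦ.trace_map, Complex.sub_re] at h
  linarith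

/-- The eigenvalues of `Φ A` are obtained from those of `A` by a doubly stochastic matrix. -/
lemma exists_doublyStochastic (hΦ : IsPosUnitalTP Φ) (hA : A.IsHermitian)
    (hB : (Φ A).IsHermitian) :
    ∃ D : Fin n → Fin n → ℝ, (∀ j i, 0 ≤ D j i) ∧ (∀ j, ∑ i, D j i = 1) ∧
      (∀ i, ∑ j, D j i = 1) ∧ ∀ j, hB.eigenvalues j = ∑ i, D j i * hA.eigenvalues i := by
  refine ⟨fun j i => (eigenproj hB j * Φ (eigenproj hA i)).trace.re, fun j i => ?_, fun j => ?_,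
    fun i => ?_, fun j => ?_⟩
  · exact (Complex.nonneg_iff.1 (trace_mul_nonneg (eigenproj_posSemidef hB j)
      (hΦ.pos _ (eigenproj_posSemidef hA i)))).1
  · rw [← Complex.re_sum, ← Matrix.trace_sum, ← Finset.mul_sum, ← map_sum, sum_eigenproj,
      hΦ.unital, mul_one, trace_eigenproj, Complex.one_re]
  · rw [← Complex.re_sum, ← Matrix.trace_sum, ← Finset.sum_mul, sum_eigenproj, one_mul,
      hΦ.trace_map, trace_eigenproj, Complex.one_re]
  · have h1 : (eigenproj hB j * Φ A).trace = (hB.eigenvalues j : ℂ) := by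
      refine (congrArg (fun X => (eigenproj hB j * X).trace) (eq_sum_eigenproj hB)).trans ?_
      simp [Finset.mul_sum, eigenproj_mul, trace_eigenproj, apply_ite]
    have h2 : (eigenproj hB j * Φ A).trace
        = ∑ i, (hA.eigenvalues i : ℂ) * (eigenproj hB j * Φ (eigenproj hA i)).trace := by
      have h3 : Φ A = ∑ i, (hA.eigenvalues i : ℂ) • Φ (eigenproj hA i) := by
        conv_lhs => rw [eq_sum_eigenproj hA]
        simp
      refine (congrArg (fun X => (eigenproj hB j * X).trace) h3).trans ?_
      simp [Finset.mul_sum, Matrix.trace_sum]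
    have h3 := congrArg Complex.re (h1.symm.trans h2)
    simpa [Complex.re_sum, mul_comm] using h3

lemma trace_mul_self_of_trace_mpow_eq (hΦ : IsPosUnitalTP Φ) (hA : A.PosSemidef) {q : ℝ}
    (hq0 : 0 < q) (hq1 : q < 1) (h : (mpow (Φ A) q).trace.re = (mpow A q).trace.re) :
    (Φ A * Φ A).trace = (A * A).trace := by
  have hB := hΦ.pos A hA
  obtain ⟨D, hD, hrow, hcol, hDb⟩ := hΦ.exists_doublyStochastic hA.isHermitian hB.isHermitian
  rw [mpow_eq_cfc_rpow _ hq0, mpow_eq_cfc_rpow _ hq0, trace_cfc hA.isHermitian,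
    trace_cfc hB.isHermitian, Complex.re_sum, Complex.re_sum] at h
  simp only [Complex.ofReal_re] at h
  rw [trace_mul_self hA.isHermitian, trace_mul_self hB.isHermitian, ← Complex.ofReal_sum,
    ← Complex.ofReal_sum]
  have ha := hA.eigenvalues_nonneg
  set a := hA.isHermitian.eigenvalues
  set b := hB.isHermitian.eigenvalues
  have hswap : ∀ f : ℝ → ℝ, ∑ j, ∑ i, D j i * f (a i) = ∑ i, f (a i) := fun f => by
    rw [Finset.sum_comm]
    simp_rw [← Finset.sum_mul, hcol, one_mul]
  have hconc := Real.strictConcaveOn_rpow hq0 hq1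
  have hle : ∀ j ∈ Finset.univ, ∑ i, D j i * a i ^ q ≤ b j ^ q := fun j _ => by
    simpa [hDb j] using hconc.concaveOn.le_map_sum (t := Finset.univ) (w := D j) (p := a)
      (fun i _ => hD j i) (hrow j) fun i _ => ha i
  have heq := (Finset.sum_eq_sum_iff_of_le hle).1 ((hswap fun x => x ^ q).trans h.symm)
  have hab : ∀ j i, D j i ≠ 0 → a i = b j := fun j i hne => by
    have := (hconc.map_sum_eq_iff' (t := Finset.univ) (w := D j) (p := a)
      (fun i _ => hD j i) (hrow j) fun i _ => ha i).1
      (by simpa [← hDb j] using (heq j (Finset.mem_univ j)).symm) i (Finset.mem_univ i) hne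
    simpa [← hDb j] using this
  rw [← hswap fun x => x * x]
  congr 1
  refine Finset.sum_congr rfl fun j _ => ?_
  rw [← one_mul (b j * b j), ← hrow j, Finset.sum_mul]
  refine Finset.sum_congr rfl fun i _ => ?_
  by_cases hne : D j i = 0
  · simp [hne]
  · rw [hab j i hne]

end IsPosUnitalTP

section Adjoint

variable {n : ℕ} {Φ : Matrix (Fin n) (Fin n) ℂ →ₗ[ℂ] Matrix (Fin n) (Fin n) ℂ}
  {A X Y : Matrix (Fin n) (Fin n) ℂ}

/-- `adjointMap` as a linear map. -/
noncomputable def adjointLinearMap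
    (Φ : Matrix (Fin n) (Fin n) ℂ →ₗ[ℂ] Matrix (Fin n) (Fin n) ℂ) :
    Matrix (Fin n) (Fin n) ℂ →ₗ[ℂ] Matrix (Fin n) (Fin n) ℂ where
  toFun := adjointMap Φ
  map_add' X Y := by ext; simp [adjointMap, mul_add]
  map_smul' c X := by ext; simp [adjointMap]

namespace IsPosUnitalTP

lemma trace_map_mul (hΦ : IsPosUnitalTP Φ) (X Y : Matrix (Fin n) (Fin n) ℂ) :
    (Φ X * Y).trace = (X * adjointLinearMap Φ Y).trace := by
  have h : ∀ i j, adjointLinearMap Φ Y i j = (Φ (Matrix.single j i 1) * Y).trace := fun i j => by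
    change ((Φ (Matrix.single i j 1))ᴴ * Y).trace = _
    rw [← hΦ.map_conjTranspose, Matrix.conjTranspose_single, star_one]
  conv_lhs => rw [Matrix.matrix_eq_sum_single X]
  simp only [map_sum, Finset.sum_mul, Matrix.trace_sum]
  rw [Matrix.trace]
  refine Finset.sum_congr rfl fun i _ => ?_
  rw [Matrix.diag_apply, Matrix.mul_apply]
  refine Finset.sum_congr rfl fun j _ => ?_
  rw [h, ← mul_one (X i j), ← smul_eq_mul (X i j) 1, ← Matrix.smul_single, map_smul]
  simp

/-- The adjoint of a positive, unital and trace-preserving map is again of this type. -/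
lemma adjoint (hΦ : IsPosUnitalTP Φ) : IsPosUnitalTP (adjointLinearMap Φ) where
  pos Y hY := by
    refine .of_dotProduct_mulVec_nonneg ?_ fun v => ?_
    · ext i j
      change star ((Φ (Matrix.single j i 1))ᴴ * Y).trace = ((Φ (Matrix.single i j 1))ᴴ * Y).trace
      rw [← Matrix.trace_conjTranspose, Matrix.conjTranspose_mul, hY.isHermitian.eq,
        Matrix.conjTranspose_conjTranspose, ← hΦ.map_conjTranspose, Matrix.conjTranspose_single,
        star_one, Matrix.trace_mul_comm]
    · have h := trace_mul_nonneg (hΦ.pos _ (Matrix.posSemidef_vecMulVec_self_star v)) hY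
      rw [hΦ.trace_map_mul, Matrix.vecMulVec_mul, Matrix.trace_vecMulVec] at h
      rwa [dotProduct_comm, ← Matrix.dotProduct_mulVec] at h
  unital := by
    ext i j
    change ((Φ (Matrix.single i j 1))ᴴ * 1).trace = _
    rw [mul_one, ← hΦ.map_conjTranspose, hΦ.trace_map, Matrix.conjTranspose_single, star_one,
      Matrix.one_apply]
    split_ifs with hij
    · simp [hij]
    · exact Matrix.trace_single_eq_of_ne _ _ _ (Ne.symm hij)
  trace_map Y := by
    have := hΦ.trace_map_mul 1 Y
    rw [hΦ.unital, one_mul, one_mul] at this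
    exact this.symm

lemma re_trace_mul_self_map_le (hΦ : IsPosUnitalTP Φ) (hA : A.IsHermitian) :
    (Φ A * Φ A).trace.re ≤ (A * A).trace.re := by
  have h := (Complex.nonneg_iff.1 (hΦ.kadison hA).trace_nonneg).1
  rw [Matrix.trace_sub, hΦ.trace_map, Complex.sub_re] at h
  linarith

/-- A Hermitian matrix whose Hilbert-Schmidt norm is preserved is recovered by the adjoint. -/
lemma adjoint_map_eq_self (hΦ : IsPosUnitalTP Φ) (hA : A.IsHermitian)
    (h : (Φ A * Φ A).trace = (A * A).trace) : adjointLinearMap Φ (Φ A) = A := by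
  have hB := hΦ.isHermitian_map hA
  have hC := hΦ.adjoint.isHermitian_map hB
  set C := adjointLinearMap Φ (Φ A) with hCdef
  have h1 : (A * C).trace = (A * A).trace := by rw [← hΦ.trace_map_mul, h]
  have h2 := hΦ.adjoint.re_trace_mul_self_map_le hB
  rw [h, ← hCdef] at h2
  have hCA : (C - A).IsHermitian := hC.sub hA
  have h3 : ((C - A)ᴴ * (C - A)).trace = (C * C).trace - (A * A).trace := by
    rw [hCA.eq, sub_mul, mul_sub, mul_sub, Matrix.trace_sub, Matrix.trace_sub, Matrix.trace_sub,
      Matrix.trace_mul_comm C A, h1]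
    ring
  have h4 := Complex.nonneg_iff.1 (Matrix.posSemidef_conjTranspose_mul_self (C - A)).trace_nonneg
  have h5 : ((C - A)ᴴ * (C - A)).trace = 0 := by
    refine Complex.ext (le_antisymm ?_ h4.1) h4.2.symm
    rw [h3, Complex.sub_re, Complex.zero_re]
    linarith
  exact sub_eq_zero.1 (Matrix.trace_conjTranspose_mul_self_eq_zero_iff.1 h5)

lemma adjoint_fixed (hΦ : IsPosUnitalTP Φ) (hA : A.IsHermitian) (h : Φ A = A) :
    adjointLinearMap Φ A = A := by
  simpa [h] using hΦ.adjoint_map_eq_self hA (by rw [h])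

end IsPosUnitalTP

end Adjoint

section Support

variable {n : ℕ} {σ A P Z : Matrix (Fin n) (Fin n) ℂ}

/-- The orthogonal projection onto the support of a Hermitian matrix. -/
noncomputable def supportProj (σ : Matrix (Fin n) (Fin n) ℂ) : Matrix (Fin n) (Fin n) ℂ :=
  cfc (fun x : ℝ => if x = 0 then 0 else 1) σ

lemma supportProj_mul_self (σ : Matrix (Fin n) (Fin n) ℂ) :
    supportProj σ * supportProj σ = supportProj σ := by
  rw [supportProj, cfc_mul_cfc]
  congr 1
  ext x
  split_ifs <;> simp

lemma mul_supportProj_self (hσ : σ.IsHermitian) : σ * supportProj σ = σ := by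
  have h : cfc (fun x : ℝ => x) σ = σ := cfc_id' ℝ σ (ha := hσ)
  rw [supportProj, mul_cfc hσ]
  refine Eq.trans (congrArg (fun f => cfc f σ) ?_) h
  ext x
  split_ifs with hx <;> simp [hx]

lemma mul_eq_self_of_self_mul (hP : P.IsHermitian) (hA : A.IsHermitian) (h : P * A = A) :
    A * P = A := by
  simpa [hP.eq, hA.eq] using congrArg Matrix.conjTranspose h

lemma supportProj_mul_of_ker_le (hσ : σ.IsHermitian) (hA : A.IsHermitian)
    (h : ∀ v : Fin n → ℂ, σ *ᵥ v = 0 → A *ᵥ v = 0) : supportProj σ * A = A := by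
  have h1 : A * (1 - supportProj σ) = 0 := by
    refine Matrix.ext_of_mulVec_single fun i => ?_
    rw [← Matrix.mulVec_mulVec, Matrix.zero_mulVec]
    refine h _ ?_
    rw [Matrix.mulVec_mulVec, mul_sub, mul_one, mul_supportProj_self hσ, sub_self,
      Matrix.zero_mulVec]
  have h2 : A * supportProj σ = A := by
    rw [mul_sub, mul_one] at h1
    exact (sub_eq_zero.1 h1).symm
  have hP : (supportProj σ).IsHermitian := isHermitian_cfc _ _
  simpa [hA.eq, hP.eq] using congrArg Matrix.conjTranspose h2

lemma mul_mpow_of_mul_eq_self (hA : A.IsHermitian) (h : P * A = A) (p : ℝ) :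
    P * mpow A p = mpow A p := by
  have h1 : mpow A p = A * cfc (fun x : ℝ => if x = 0 then 0 else x ^ (p - 1)) A := by
    rw [mul_cfc hA, mpow]
    congr 1
    ext x
    split_ifs with hx
    · simp
    · rw [Real.rpow_sub_one hx, mul_div_cancel₀ _ hx]
  rw [h1, ← mul_assoc, h]

/-- On matrices supported on `supp σ`, conjugation by a power of `σ` is injective. -/
lemma eq_zero_of_mpow_mul_mul_mpow_eq_zero (hσ : σ.PosSemidef) {s : ℝ}
    (hl : supportProj σ * Z = Z) (hr : Z * supportProj σ = Z)
    (h : mpow σ s * Z * mpow σ s = 0) : Z = 0 := by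
  have hinv : mpow σ (-s) * mpow σ s = supportProj σ := by
    rw [mpow, mpow, cfc_mul_cfc, supportProj]
    refine cfc_congr_eigenvalues hσ.isHermitian fun i => ?_
    split_ifs with hx
    · simp
    · have := (hσ.eigenvalues_nonneg i).lt_of_ne' hx
      rw [← Real.rpow_add this, neg_add_cancel, Real.rpow_zero]
  have hinv' : mpow σ s * mpow σ (-s) = supportProj σ := by
    rw [mpow, mpow, cfc_mul_cfc, ← hinv, mpow, mpow, cfc_mul_cfc]
    simp_rw [mul_comm]
  calc Z = supportProj σ * Z * supportProj σ := by rw [hl, hr]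
    _ = mpow σ (-s) * (mpow σ s * Z * mpow σ s) * mpow σ (-s) := by
      rw [← hinv]
      nth_rw 2 [hinv]
      rw [← hinv']
      noncomm_ring
    _ = 0 := by rw [h, mul_zero, zero_mul]

end Support

namespace IsPosUnitalTP

variable {n : ℕ} {Φ : Matrix (Fin n) (Fin n) ℂ →ₗ[ℂ] Matrix (Fin n) (Fin n) ℂ}
  {σ X : Matrix (Fin n) (Fin n) ℂ} {p z : ℝ}

lemma supportProj_mul_map (hΦ : IsPosUnitalTP Φ) (hσ : σ.IsHermitian) (hfix : Φ σ = σ)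
    (hX : X.IsHermitian) (h : supportProj σ * X = X) : supportProj σ * Φ X = Φ X := by
  have hP : (supportProj σ).IsHermitian := isHermitian_cfc _ _
  have h1 := hΦ.map_sandwich_of_fixed hP hX (hΦ.map_cfc_of_fixed hσ hfix _)
  rw [h, mul_eq_self_of_self_mul hP hX h] at h1
  rw [h1, ← mul_assoc, ← mul_assoc, supportProj_mul_self]

lemma mpow_sandwich (hΦ : IsPosUnitalTP Φ) (hσ : σ.IsHermitian) (hfix : Φ σ = σ)
    (hX : X.IsHermitian) (s : ℝ) :
    Φ (mpow σ s * X * mpow σ s) = mpow σ s * Φ X * mpow σ s :=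
  hΦ.map_sandwich_of_fixed (isHermitian_mpow _ _) hX (hΦ.map_cfc_of_fixed hσ hfix _)

lemma sandwich_mpow_posSemidef (hX : X.PosSemidef) (σ : Matrix (Fin n) (Fin n) ℂ) (s : ℝ) :
    (mpow σ s * X * mpow σ s).PosSemidef := by
  have := hX.mul_mul_conjTranspose_same (mpow σ s)
  rwa [(isHermitian_mpow σ s).eq] at this

lemma sandwich_mpow_map_sub_posSemidef (hΦ : IsPosUnitalTP Φ) (hσ : σ.IsHermitian)
    (hfix : Φ σ = σ) (hX : X.PosSemidef) (s : ℝ) (hp0 : 0 < p) (hp1 : p ≤ 1) :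
    (mpow σ s * mpow (Φ X) p * mpow σ s
      - Φ (mpow σ s * mpow X p * mpow σ s)).PosSemidef := by
  rw [hΦ.mpow_sandwich hσ hfix (isHermitian_mpow _ _), ← sub_mul, ← mul_sub]
  exact sandwich_mpow_posSemidef (hΦ.mpow_map_sub_posSemidef hX hp0 hp1) σ s

/-- The trace functional of the `α`-`z`-Rényi divergence splits monotonically through
`Φ (σ ^ s * X ^ p * σ ^ s)`. -/
lemma re_trace_sandwich_le (hΦ : IsPosUnitalTP Φ) (hσ : σ.IsHermitian) (hfix : Φ σ = σ)
    (hX : X.PosSemidef) (s : ℝ) (hp0 : 0 < p) (hp1 : p ≤ 1) (hz0 : 0 < z) (hz1 : z ≤ 1) :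
    (mpow (mpow σ s * mpow X p * mpow σ s) z).trace.re
        ≤ (mpow (Φ (mpow σ s * mpow X p * mpow σ s)) z).trace.re ∧
      (mpow (Φ (mpow σ s * mpow X p * mpow σ s)) z).trace.re
        ≤ (mpow (mpow σ s * mpow (Φ X) p * mpow σ s) z).trace.re := by
  have hY := sandwich_mpow_posSemidef (mpow_posSemidef hX p) σ s
  refine ⟨hΦ.re_trace_mpow_le hY hz0 hz1, ?_⟩
  have h := (Complex.nonneg_iff.1 (mpow_sub_mpow_posSemidef (hΦ.pos _ hY)
    (hΦ.sandwich_mpow_map_sub_posSemidef hσ hfix hX s hp0 hp1) hz0 hz1).trace_nonneg).1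
  rw [Matrix.trace_sub, Complex.sub_re] at h
  linarith

/-- Equality in the data processing inequality forces recoverability by the adjoint. -/
lemma adjoint_map_eq_self_of_trace_eq (hΦ : IsPosUnitalTP Φ) (hσ : σ.PosSemidef)
    (hfix : Φ σ = σ) (hX : X.PosSemidef) (hsupp : supportProj σ * X = X) (s : ℝ) (hp0 : 0 < p)
    (hp1 : p ≤ 1) (hz0 : 0 < z) (hz1 : z ≤ 1) (hpz : p < 1 ∨ z < 1)
    (h : (mpow (mpow σ s * mpow (Φ X) p * mpow σ s) z).trace.re
      = (mpow (mpow σ s * mpow X p * mpow σ s) z).trace.re) :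
    adjointLinearMap Φ (Φ X) = X := by
  have hσH := hσ.isHermitian
  have hP : (supportProj σ).IsHermitian := isHermitian_cfc _ _
  have hΦX := hΦ.pos X hX
  have hsuppΦ := hΦ.supportProj_mul_map hσH hfix hX.isHermitian hsupp
  have hY := sandwich_mpow_posSemidef (mpow_posSemidef hX p) σ s
  obtain ⟨h1, h2⟩ := hΦ.re_trace_sandwich_le hσH hfix hX s hp0 hp1 hz0 hz1
  rcases hp1.lt_or_eq with hp | rfl
  · have h3 := eq_of_trace_mpow_eq (hΦ.pos _ hY)
      (hΦ.sandwich_mpow_map_sub_posSemidef hσH hfix hX s hp0 hp1) hz0 hz1 (by linarith)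
    rw [hΦ.mpow_sandwich hσH hfix (isHermitian_mpow _ _), ← sub_eq_zero, ← sub_mul,
      ← mul_sub] at h3
    have hl : supportProj σ * (mpow (Φ X) p - Φ (mpow X p)) = mpow (Φ X) p - Φ (mpow X p) := by
      rw [mul_sub, mul_mpow_of_mul_eq_self hΦX.isHermitian hsuppΦ p,
        hΦ.supportProj_mul_map hσH hfix (isHermitian_mpow _ _)
          (mul_mpow_of_mul_eq_self hX.isHermitian hsupp p)]
    have h4 := eq_zero_of_mpow_mul_mul_mpow_eq_zero hσ hl (mul_eq_self_of_self_mul hP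
      ((isHermitian_mpow _ _).sub (hΦ.isHermitian_map (isHermitian_mpow _ _))) hl) h3
    refine hΦ.adjoint_map_eq_self hX.isHermitian
      (hΦ.trace_mul_self_of_trace_mpow_eq hX hp0 hp ?_)
    rw [sub_eq_zero.1 h4, hΦ.trace_map]
  · have hz : z < 1 := hpz.resolve_left (lt_irrefl _)
    have h3 := hΦ.adjoint_map_eq_self hY.isHermitian
      (hΦ.trace_mul_self_of_trace_mpow_eq hY hz0 hz (by linarith))
    rw [mpow_one hX.isHermitian, hΦ.mpow_sandwich hσH hfix hX.isHermitian,
      hΦ.adjoint.mpow_sandwich hσH (hΦ.adjoint_fixed hσH hfix) hΦX.isHermitian,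
      ← sub_eq_zero, ← sub_mul, ← mul_sub] at h3
    have hl : supportProj σ * (adjointLinearMap Φ (Φ X) - X) = adjointLinearMap Φ (Φ X) - X := by
      rw [mul_sub, hsupp, hΦ.adjoint.supportProj_mul_map hσH (hΦ.adjoint_fixed hσH hfix)
        hΦX.isHermitian hsuppΦ]
    exact sub_eq_zero.1 (eq_zero_of_mpow_mul_mul_mpow_eq_zero hσ hl (mul_eq_self_of_self_mul hP
      ((hΦ.adjoint.isHermitian_map hΦX.isHermitian).sub hX.isHermitian) hl) h3)

end IsPosUnitalTP

/-- for a positive unital trace-preserving `Φ` fixing `σ`, positive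
semidefinite `ρ` with `supp ρ ⊆ supp σ`, and `0 < α < 1`, `α ≤ z ≤ 1`, the
α-z-Rényi divergence is preserved by `Φ` if and only if `Φ*∘Φ` fixes both `ρ` and `σ`. -/
theorem stmt7 {n : ℕ}
    (Φ : Matrix (Fin n) (Fin n) ℂ →ₗ[ℂ] Matrix (Fin n) (Fin n) ℂ)
    (hΦpos : ∀ X, X.PosSemidef → (Φ X).PosSemidef)
    (hΦunital : Φ 1 = 1) (hΦtr : ∀ X, (Φ X).trace = X.trace)
    (σ : Matrix (Fin n) (Fin n) ℂ) (hσ : σ.PosSemidef) (hfix : Φ σ = σ)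
    (ρ : Matrix (Fin n) (Fin n) ℂ) (hρ : ρ.PosSemidef)
    (hsupp : ∀ v : Fin n → ℂ, σ *ᵥ v = 0 → ρ *ᵥ v = 0)
    (α z : ℝ) (hα0 : 0 < α) (hα1 : α < 1) (hαz : α ≤ z) (hz1 : z ≤ 1) :
    (Matrix.trace (mpow (mpow σ ((1 - α) / (2 * z)) * mpow (Φ ρ) (α / z) *
        mpow σ ((1 - α) / (2 * z))) z)).re
      = (Matrix.trace (mpow (mpow σ ((1 - α) / (2 * z)) * mpow ρ (α / z) *
          mpow σ ((1 - α) / (2 * z))) z)).re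
    ↔ (adjointMap Φ (Φ ρ) = ρ ∧ adjointMap Φ (Φ σ) = σ) := by
  have hΦ : IsPosUnitalTP Φ := ⟨hΦpos, hΦunital, hΦtr⟩
  have hz0 : 0 < z := hα0.trans_le hαz
  have hp0 : 0 < α / z := div_pos hα0 hz0
  have hp1 : α / z ≤ 1 := (div_le_one hz0).2 hαz
  have hσfix : adjointMap Φ σ = σ := hΦ.adjoint_fixed hσ.isHermitian hfix
  constructor
  · intro h
    refine ⟨?_, by rw [hfix, hσfix]⟩
    refine hΦ.adjoint_map_eq_self_of_trace_eq hσ hfix hρ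
      (supportProj_mul_of_ker_le hσ.isHermitian hρ.isHermitian hsupp) _ hp0 hp1 hz0 hz1 ?_ h
    rcases hz1.lt_or_eq with hz | rfl
    · exact .inr hz
    · exact .inl (by simpa using hα1)
  · rintro ⟨hρrec, -⟩
    have h1 := hΦ.re_trace_sandwich_le hσ.isHermitian hfix hρ ((1 - α) / (2 * z)) hp0 hp1 hz0 hz1
    have h2 := hΦ.adjoint.re_trace_sandwich_le hσ.isHermitian hσfix (hΦ.pos ρ hρ)
      ((1 - α) / (2 * z)) hp0 hp1 hz0 hz1
    rw [show adjointLinearMap Φ (Φ ρ) = ρ from hρrec] at h2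
    exact le_antisymm (h2.1.trans h2.2) (h1.1.trans h1.2)
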